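/- Let p be a polynomial of degree d whose f*-vector is nonnegative and integral, i.e., p(k) = Σ_{i=0}^{d} f*_i · C(k−1, i) with every f*_i a nonnegative integer. Then there exist n and a set X ⊆ ℝ^n that is a finite disjoint union of relative interiors of simplices with vertices in ℤ^n, such that p(k) = #(ℤ^n ∩ k·X) for every positive integer k. -/

import Mathlib

open scoped Pointwise

section StandardFaces

variable {n : ℕ}

/-- The standard basis vectors of `ℤⁿ` indexed by `S`. -/
def faceVertices (S : Finset (Fin n)) : Finset (Fin n → ℤ) :=
  S.image fun v => Pi.single v 1

/-- The relatively open face of the standard simplex spanned by the basis vectors in `S`. -/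
def openFace (S : Finset (Fin n)) : Set (Fin n → ℝ) :=
  {x | (∀ v ∈ S, 0 < x v) ∧ (∀ v ∉ S, x v = 0) ∧ ∑ v, x v = 1}

theorem cast_single (v : Fin n) :
    (fun i => (((Pi.single v 1 : Fin n → ℤ) i : ℤ) : ℝ)) = Pi.single v 1 := by
  ext i
  by_cases h : i = v <;> simp [h]

theorem cast_image_faceVertices (S : Finset (Fin n)) :
    (fun y : Fin n → ℤ => fun i => (y i : ℝ)) '' ↑(faceVertices S) =
      (fun v => (Pi.single v 1 : Fin n → ℝ)) '' ↑S := by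
  rw [faceVertices, Finset.coe_image, Set.image_image]
  exact Set.image_congr fun v _ => cast_single v

theorem affineIndependent_faceVertices (S : Finset (Fin n)) :
    AffineIndependent ℝ
      (fun q : {x // x ∈ faceVertices S} => (fun i => ((q : Fin n → ℤ) i : ℝ))) := by
  have h := (Pi.linearIndependent_single_one (Fin n) ℝ).affineIndependent
  have hv : ∀ q : {x // x ∈ faceVertices S}, ∃ v : Fin n, Pi.single v 1 = (q : Fin n → ℤ) := by
    intro q
    obtain ⟨v, -, hv⟩ := Finset.mem_image.mp q.2
    exact ⟨v, hv⟩
  choose e he using hv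
  have hinj : Function.Injective e := fun a b hab =>
    Subtype.ext (by rw [← he a, ← he b, hab])
  have hcast : (fun q : {x // x ∈ faceVertices S} => (fun i => ((q : Fin n → ℤ) i : ℝ))) =
      (fun v => Pi.single v 1) ∘ e := by
    funext q
    simp only [Function.comp_apply, ← he q]
    exact cast_single (e q)
  rw [hcast]
  exact h.comp_embedding ⟨e, hinj⟩

theorem convexHull_singles (S : Finset (Fin n)) :
    convexHull ℝ ((fun v => (Pi.single v 1 : Fin n → ℝ)) '' ↑S) =
      {x | (∀ v, 0 ≤ x v) ∧ (∀ v ∉ S, x v = 0) ∧ ∑ v, x v = 1} := by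
  apply Set.Subset.antisymm
  · apply convexHull_min
    · rintro _ ⟨v, hv, rfl⟩
      refine ⟨fun w => ?_, fun w hw => ?_, by simp⟩
      · by_cases h : w = v <;> simp [h]
      · have : w ≠ v := by rintro rfl; exact hw hv
        simp [this]
    · rintro x ⟨hx0, hxS, hx1⟩ y ⟨hy0, hyS, hy1⟩ a b ha hb hab
      refine ⟨fun v => ?_, fun v hv => ?_, ?_⟩
      · have := hx0 v
        have := hy0 v
        simp only [Pi.add_apply, Pi.smul_apply, smul_eq_mul]
        positivity
      · simp [hxS v hv, hyS v hv]
      · simp [Finset.sum_add_distrib, ← Finset.mul_sum, hx1, hy1, hab]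
  · rintro x ⟨hx0, hxS, hx1⟩
    have hsum : ∑ v ∈ S, x v = 1 := by
      rw [← hx1]
      exact Finset.sum_subset (Finset.subset_univ S) fun v _ hv => hxS v hv
    have hx : ∑ v ∈ S, x v • (Pi.single v 1 : Fin n → ℝ) = x := by
      ext w
      by_cases hw : w ∈ S <;> simp [Finset.sum_apply, Pi.single_apply, hw, hxS]
    rw [← hx]
    exact (convex_convexHull ℝ _).sum_mem (fun v _ => hx0 v) hsum fun v hv =>
      subset_convexHull ℝ _ ⟨v, hv, rfl⟩

theorem support_and_sum_of_mem_affineSpan_singles (S : Finset (Fin n)) {x : Fin n → ℝ}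
    (hx : x ∈ affineSpan ℝ ((fun v => (Pi.single v 1 : Fin n → ℝ)) '' ↑S)) :
    (∀ v ∉ S, x v = 0) ∧ ∑ v, x v = 1 := by
  refine affineSpan_induction (p := fun x => (∀ v ∉ S, x v = 0) ∧ ∑ v, x v = 1) hx ?_ ?_
  · rintro _ ⟨v, hv, rfl⟩
    refine ⟨fun w hw => ?_, by simp⟩
    have : w ≠ v := by rintro rfl; exact hw hv
    simp [this]
  · rintro c u v w ⟨hu, hu1⟩ ⟨hv, hv1⟩ ⟨hw, hw1⟩
    refine ⟨fun i hi => by simp [hu i hi, hv i hi, hw i hi], ?_⟩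
    simp [Finset.sum_add_distrib, ← Finset.mul_sum, hu1, hv1, hw1]

theorem intrinsicInterior_singles (S : Finset (Fin n)) :
    intrinsicInterior ℝ (convexHull ℝ ((fun v => (Pi.single v 1 : Fin n → ℝ)) '' ↑S)) =
      openFace S := by
  ext x
  rw [mem_intrinsicInterior]
  constructor
  · rintro ⟨y, hy, rfl⟩
    have hyH := interior_subset hy
    obtain ⟨h0, hS, h1⟩ := (convexHull_singles S).subset hyH
    refine ⟨fun v hv => ?_, hS, h1⟩
    by_contra hneg
    have hyv : (y : Fin n → ℝ) v = 0 := le_antisymm (not_lt.mp hneg) (h0 v)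
    have he : (Pi.single v 1 : Fin n → ℝ) ∈
        affineSpan ℝ (convexHull ℝ ((fun v => (Pi.single v 1 : Fin n → ℝ)) '' ↑S)) :=
      subset_affineSpan ℝ _ (subset_convexHull ℝ _ ⟨v, hv, rfl⟩)
    let γ : ℝ → affineSpan ℝ (convexHull ℝ ((fun v => (Pi.single v 1 : Fin n → ℝ)) '' ↑S)) :=
      fun t => ⟨AffineMap.lineMap (y : Fin n → ℝ) (Pi.single v 1) t,
        AffineMap.lineMap_mem t y.2 he⟩
    have hγ : Continuous γ := by
      refine Continuous.subtype_mk ?_ _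
      exact AffineMap.lineMap_continuous
    have hγ0 : γ 0 = y := Subtype.ext (by simp [γ])
    have hmem := hγ.continuousAt.preimage_mem_nhds
      (by rw [hγ0]; exact mem_interior_iff_mem_nhds.mp hy)
    obtain ⟨ε, hε, hball⟩ := Metric.mem_nhds_iff.mp hmem
    have hin : -(ε / 2) ∈ Metric.ball (0 : ℝ) ε := by
      rw [Metric.mem_ball, Real.dist_eq, sub_zero, abs_neg, abs_of_pos (by positivity)]
      linarith
    have hpt := hball hin
    have hv0 := ((convexHull_singles S).subset hpt).1 v
    simp [γ, AffineMap.lineMap_apply, hyv] at hv0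
    linarith
  · rintro ⟨hpos, hS, h1⟩
    have hxH : x ∈ convexHull ℝ ((fun v => (Pi.single v 1 : Fin n → ℝ)) '' ↑S) := by
      rw [convexHull_singles]
      refine ⟨fun v => ?_, hS, h1⟩
      by_cases hv : v ∈ S
      · exact (hpos v hv).le
      · exact (hS v hv).ge
    refine ⟨⟨x, subset_affineSpan ℝ _ hxH⟩, ?_, rfl⟩
    have hopen : IsOpen {y : Fin n → ℝ | ∀ v ∈ S, 0 < y v} := by
      have : {y : Fin n → ℝ | ∀ v ∈ S, 0 < y v} = ⋂ v ∈ S, {y | 0 < y v} := by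
        ext y; simp
      rw [this]
      exact isOpen_biInter_finset fun v _ => isOpen_lt continuous_const (continuous_apply v)
    refine mem_interior.mpr ⟨_, ?_, hopen.preimage continuous_subtype_val, hpos⟩
    rintro ⟨y, hy⟩ hypos
    rw [affineSpan_convexHull] at hy
    obtain ⟨hyS, hy1⟩ := support_and_sum_of_mem_affineSpan_singles S hy
    refine (convexHull_singles S).superset ⟨fun v => ?_, hyS, hy1⟩
    by_cases hv : v ∈ S
    · exact (hypos v hv).le
    · exact (hyS v hv).ge

theorem intrinsicInterior_faceVertices (S : Finset (Fin n)) :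
    intrinsicInterior ℝ
      (convexHull ℝ ((fun y : Fin n → ℤ => fun i => (y i : ℝ)) '' ↑(faceVertices S))) =
      openFace S := by
  rw [cast_image_faceVertices, intrinsicInterior_singles]

theorem disjoint_openFace {S T : Finset (Fin n)} (h : S ≠ T) :
    Disjoint (openFace S) (openFace T) := by
  rw [Set.disjoint_left]
  rintro x ⟨hS, hS0, -⟩ ⟨hT, hT0, -⟩
  apply h
  ext v
  constructor
  · intro hv
    by_contra hv'
    exact (hS v hv).ne' (hT0 v hv')
  · intro hv
    by_contra hv'
    exact (hT v hv).ne' (hS0 v hv')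

/-- The lattice points in the `k`-th dilate of `openFace S`. -/
def facePoints (S : Finset (Fin n)) (k : ℕ) : Set (Fin n → ℤ) :=
  {x | (∀ v ∈ S, 0 < x v) ∧ (∀ v ∉ S, x v = 0) ∧ ∑ v, x v = k}

theorem cast_mem_smul_openFace {S : Finset (Fin n)} {k : ℕ} (hk : 0 < k) (x : Fin n → ℤ) :
    (fun i => (x i : ℝ)) ∈ (k : ℝ) • openFace S ↔ x ∈ facePoints S k := by
  have hk' : (0 : ℝ) < k := by exact_mod_cast hk
  rw [Set.mem_smul_set_iff_inv_smul_mem₀ hk'.ne']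
  simp only [openFace, facePoints, Set.mem_ofPred_eq, Pi.smul_apply, smul_eq_mul,
    ← Finset.mul_sum]
  refine and_congr (forall₂_congr fun v _ => ?_) (and_congr (forall₂_congr fun v _ => ?_) ?_)
  · rw [mul_pos_iff_of_pos_left (by positivity)]
    exact Int.cast_pos
  · simp [hk.ne']
  · rw [inv_mul_eq_one₀ hk'.ne', eq_comm]
    norm_cast

theorem facePoints_eq_image {S : Finset (Fin n)} {k : ℕ} (h : S.card ≤ k) :
    facePoints S k =
      (fun (g : Fin n →₀ ℕ) (v : Fin n) => (g v : ℤ) + if v ∈ S then 1 else 0) ''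
        ↑(S.finsuppAntidiag (k - S.card)) := by
  ext x
  constructor
  · rintro ⟨hpos, hS, hsum⟩
    have hsumS : ∑ v ∈ S, x v = k := by
      rw [← hsum]
      exact Finset.sum_subset (Finset.subset_univ S) fun v _ hv => hS v hv
    have hnat : ∀ v ∈ S, (((x v - 1).toNat : ℕ) : ℤ) = x v - 1 := fun v hv =>
      Int.toNat_of_nonneg (by have := hpos v hv; omega)
    refine ⟨Finsupp.equivFunOnFinite.symm fun v => (x v - 1).toNat, ?_, ?_⟩
    · rw [Finset.mem_coe, Finset.mem_finsuppAntidiag]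
      refine ⟨?_, fun v hv => ?_⟩
      · simp only [Finsupp.equivFunOnFinite_symm_apply_apply]
        zify [h]
        rw [Finset.sum_congr rfl hnat]
        simp [hsumS]
      · by_contra hv'
        simp [hS v hv'] at hv
    · funext v
      by_cases hv : v ∈ S
      · simp only [Finsupp.equivFunOnFinite_symm_apply_apply, hnat v hv, hv, if_true]
        ring
      · simp [hv, hS v hv]
  · rintro ⟨g, hg, rfl⟩
    rw [Finset.mem_coe, Finset.mem_finsuppAntidiag] at hg
    obtain ⟨hsum, hsupp⟩ := hg
    have hg0 : ∀ v ∉ S, g v = 0 := fun v hv => by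
      by_contra h0
      exact hv (hsupp (Finsupp.mem_support_iff.mpr h0))
    refine ⟨fun v hv => ?_, fun v hv => ?_, ?_⟩
    · simp only [hv, if_true]; omega
    · simp [hv, hg0 v hv]
    · have : ∑ v, (g v : ℤ) = (k - S.card : ℕ) := by
        rw [← hsum]
        push_cast
        exact (Finset.sum_subset (Finset.subset_univ S) fun v _ hv => by simp [hg0 v hv]).symm
      rw [Finset.sum_add_distrib, this]
      simp [h]

theorem facePoints_eq_empty {S : Finset (Fin n)} {k : ℕ} (h : k < S.card) :
    facePoints S k = ∅ := by
  rw [Set.eq_empty_iff_forall_notMem]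
  rintro x ⟨hpos, hS, hsum⟩
  have hsumS : ∑ v ∈ S, x v = k := by
    rw [← hsum]
    exact Finset.sum_subset (Finset.subset_univ S) fun v _ hv => hS v hv
  have : ∑ v ∈ S, (1 : ℤ) ≤ ∑ v ∈ S, x v := Finset.sum_le_sum fun v hv => hpos v hv
  simp at this
  omega

theorem finite_facePoints (S : Finset (Fin n)) (k : ℕ) : (facePoints S k).Finite := by
  rcases lt_or_ge k S.card with h | h
  · simp [facePoints_eq_empty h]
  · rw [facePoints_eq_image h]
    exact (Finset.finite_toSet _).image _

theorem ncard_facePoints {S : Finset (Fin n)} {i k : ℕ} (hS : S.card = i + 1)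
    (hk : 0 < k) : (facePoints S k).ncard = (k - 1).choose i := by
  rcases lt_or_ge k S.card with h | h
  · rw [facePoints_eq_empty h, Set.ncard_empty, Nat.choose_eq_zero_of_lt (by omega)]
  · rw [facePoints_eq_image h, Set.ncard_image_of_injective, Set.ncard_coe_finset,
      Finset.card_finsuppAntidiag_nat_eq_choose, hS]
    · rw [show i + 1 + (k - (i + 1)) - 1 = k - 1 by omega, ← Nat.choose_symm (by omega)]
      congr 1
      omega
    · intro g g' hgg
      ext v
      simpa using congrFun hgg v

theorem disjoint_facePoints {S T : Finset (Fin n)} (h : S ≠ T) {k : ℕ} (hk : 0 < k) :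
    Disjoint (facePoints S k) (facePoints T k) := by
  rw [Set.disjoint_left]
  intro x hx hy
  rw [← cast_mem_smul_openFace hk, Set.mem_smul_set_iff_inv_smul_mem₀ (by positivity)] at hx hy
  exact Set.disjoint_left.mp (disjoint_openFace h) hx hy

end StandardFaces

/-- There are pairwise distinct finite sets with any prescribed finite list of positive sizes. -/
theorem exists_injective_card_eq {ι : Type*} [Fintype ι] (c : ι → ℕ) :
    ∃ (n : ℕ) (S : ι → Finset (Fin n)), Function.Injective S ∧ ∀ j, (S j).card = c j + 1 := by
  classical
  let e := Fintype.equivFin ((j : ι) × Fin (c j + 1))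
  let S : ι → Finset ((j : ι) × Fin (c j + 1)) := fun j =>
    Finset.univ.map (Function.Embedding.sigmaMk j)
  refine ⟨_, fun j => (S j).map e.toEmbedding, ?_, fun j => by simp [S]⟩
  intro a b hab
  have hS : S a = S b := Finset.map_injective _ hab
  have ha : (⟨a, 0⟩ : (j : ι) × Fin (c j + 1)) ∈ S a := by simp [S]
  rw [hS] at ha
  obtain ⟨_, -, h⟩ := Finset.mem_map.mp ha
  exact (congrArg Sigma.fst h).symm

/-- Converse of `f*`-nonnegativity (Breuer): every polynomial with nonnegative integral
`f*`-vector is the Ehrhart polynomial of some integral partial polytopal complex, namely of a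
finite disjoint union of relative interiors of simplices with integer vertices. -/
theorem fstar_nonnegative_is_ehrhart
    (d : ℕ) (p : Polynomial ℚ) (f : Fin (d + 1) → ℕ)
    (hp : ∀ k : ℕ, 0 < k →
      p.eval (k : ℚ) = ∑ i : Fin (d + 1), (f i : ℚ) * Nat.choose (k - 1) (i : ℕ)) :
    ∃ (n N : ℕ) (Δ : Fin N → Finset (Fin n → ℤ)),
      (∀ j, AffineIndependent ℝ
        (fun q : {x // x ∈ Δ j} => (fun i => ((q : Fin n → ℤ) i : ℝ)))) ∧
      Pairwise (Function.onFun Disjoint (fun j =>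
        intrinsicInterior ℝ
          (convexHull ℝ ((fun y : Fin n → ℤ => fun i => (y i : ℝ)) '' ↑(Δ j))))) ∧
      ∀ k : ℕ, 0 < k →
        p.eval (k : ℚ) =
          (Set.ncard {x : Fin n → ℤ |
            (fun i => (x i : ℝ)) ∈
              (k : ℝ) • ⋃ j, intrinsicInterior ℝ
                (convexHull ℝ ((fun y : Fin n → ℤ => fun i => (y i : ℝ)) '' ↑(Δ j)))} : ℚ) := by
  let e := Fintype.equivFin ((i : Fin (d + 1)) × Fin (f i))
  obtain ⟨n, S, hinj, hcard⟩ :=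
    exists_injective_card_eq fun j => ((e.symm j).1 : ℕ)
  refine ⟨n, _, fun j => faceVertices (S j), fun j => affineIndependent_faceVertices (S j), ?_, ?_⟩
  · intro a b hab
    simp only [Function.onFun, intrinsicInterior_faceVertices]
    exact disjoint_openFace (hinj.ne hab)
  · intro k hk
    have hset : {x : Fin n → ℤ | (fun i => (x i : ℝ)) ∈ (k : ℝ) • ⋃ j, openFace (S j)} =
        ⋃ j, facePoints (S j) k := by
      ext x
      simp only [Set.mem_ofPred_eq, Set.smul_set_iUnion, Set.mem_iUnion,
        cast_mem_smul_openFace hk]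
    simp only [intrinsicInterior_faceVertices]
    rw [hp k hk, hset, Set.ncard_iUnion_of_finite (fun j => finite_facePoints (S j) k)
      (fun a b hab => disjoint_facePoints (hinj.ne hab) hk), finsum_eq_sum_of_fintype]
    simp only [ncard_facePoints (hcard _) hk]
    rw [Equiv.sum_comp e.symm fun j => (k - 1).choose (j.1 : ℕ), Fintype.sum_sigma]
    simp
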